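/- arXiv:2007.03846 — 6 statements merged into one kernel-verified Lean document; each statement's English description precedes it below -/
import Mathlib

section
/- Let G be a real inner product space, let α > 0, and let u⁰, u¹, d, λ⁰ ∈ G. Define λ¹ := α(d − u¹) + λ⁰. Then α⟨u⁰ − d, d⟩ − ⟨λ⁰, d⟩ + ⟨λ¹, u¹⟩ = (α/2)(‖u⁰‖² − ‖u¹‖²) + (1/(2α))(‖λ⁰‖² − ‖λ¹‖²) − (α/2)‖d − u⁰‖². -/
open scoped RealInnerProductSpace

/-- The interface-term computation (the term `J`) in the proof of the unconditional
stability lemma (Lemma 3.1): with the Robin update `λ¹ = α(d − u¹) + λ⁰`,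
`α⟨u⁰ − d, d⟩ − ⟨λ⁰, d⟩ + ⟨λ¹, u¹⟩
  = (α/2)(‖u⁰‖² − ‖u¹‖²) + (1/(2α))(‖λ⁰‖² − ‖λ¹‖²) − (α/2)‖d − u⁰‖²`. -/
theorem stmt1 {G : Type*} [NormedAddCommGroup G] [InnerProductSpace ℝ G]
    (α : ℝ) (hα : 0 < α) (u₀ u₁ d lam₀ lam₁ : G)
    (hlam : lam₁ = α • (d - u₁) + lam₀) :
    α * ⟪u₀ - d, d⟫ - ⟪lam₀, d⟫ + ⟪lam₁, u₁⟫ =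
      α / 2 * (‖u₀‖ ^ 2 - ‖u₁‖ ^ 2) + 1 / (2 * α) * (‖lam₀‖ ^ 2 - ‖lam₁‖ ^ 2)
        - α / 2 * ‖d - u₀‖ ^ 2 := by
  subst hlam
  simp only [← real_inner_self_eq_norm_sq, inner_add_left, inner_add_right, inner_sub_left,
    inner_sub_right, real_inner_smul_left, real_inner_smul_right]
  rw [real_inner_comm d u₀, real_inner_comm d u₁, real_inner_comm d lam₀,
    real_inner_comm u₁ lam₀]
  field_simp
  ring
end

section
/- Let V_s, V_f and G be real inner product spaces, let a_s : V_s × V_s → ℝ be a symmetric bilinear form, and let ρ_s, ρ_f, α, Δt > 0. Suppose η⁰, η¹, q⁰, q¹ ∈ V_s, u⁰, u¹ ∈ V_f, λ⁰, λ¹, U⁰, U¹, Q ∈ G and D ∈ ℝ satisfy: (i) (q¹ + q⁰)/2 = (η¹ − η⁰)/Δt; (ii) ρ_s⟨(q¹ − q⁰)/Δt, (q¹ + q⁰)/2⟩_s + a_s((η¹ + η⁰)/2, (q¹ + q⁰)/2) + α⟨Q − U⁰, Q⟩_G + ⟨λ⁰, Q⟩_G = 0; (iii) ρ_f⟨(u¹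 − u⁰)/Δt, u¹⟩_f + D + α⟨U¹ − Q, U¹⟩_G − ⟨λ⁰, U¹⟩_G = 0; (iv) λ¹ = α(Q − U¹) + λ⁰. Define S^i := a_s(η^i, η^i) + ρ_s‖q^i‖_s² + ρ_f‖u^i‖_f² + Δt(α‖U^i‖_G² + (1/α)‖λ^i‖_G²) for i = 0, 1. Then S¹ + ρ_f‖u¹ − u⁰‖_f² + 2ΔtD + αΔt‖Q − U⁰‖_G² = S⁰. -/
open scoped RealInnerProductSpace

/-- Single-step energy identity underlying the unconditional stability lemma
(Lemma 3.1) of the fully discrete Robin-based loosely coupled scheme. -/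
theorem stmt2 {Vs Vf G : Type*}
    [NormedAddCommGroup Vs] [InnerProductSpace ℝ Vs]
    [NormedAddCommGroup Vf] [InnerProductSpace ℝ Vf]
    [NormedAddCommGroup G] [InnerProductSpace ℝ G]
    (aₛ : Vs →ₗ[ℝ] Vs →ₗ[ℝ] ℝ) (hsym : ∀ x y : Vs, aₛ x y = aₛ y x)
    (ρs ρf α Δt : ℝ) (hρs : 0 < ρs) (hρf : 0 < ρf) (hα : 0 < α) (hΔt : 0 < Δt)
    (η₀ η₁ q₀ q₁ : Vs) (u₀ u₁ : Vf) (lam₀ lam₁ U₀ U₁ Q : G) (D : ℝ)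
    -- (i) the kinematic relation of the midpoint solid scheme
    (h1 : (2:ℝ)⁻¹ • (q₁ + q₀) = Δt⁻¹ • (η₁ - η₀))
    -- (ii) the solid subproblem tested with the midpoint solid velocity
    (h2 : ρs * ⟪Δt⁻¹ • (q₁ - q₀), (2:ℝ)⁻¹ • (q₁ + q₀)⟫
        + aₛ ((2:ℝ)⁻¹ • (η₁ + η₀)) ((2:ℝ)⁻¹ • (q₁ + q₀))
        + α * ⟪Q - U₀, Q⟫ + ⟪lam₀, Q⟫ = 0)
    -- (iii) the fluid subproblem tested with the fluid velocity
    (h3 : ρf * ⟪Δt⁻¹ • (u₁ - u₀), u₁⟫ + D + α * ⟪U₁ - Q, U₁⟫ - ⟪lam₀, U₁⟫ = 0)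
    -- (iv) the multiplier update
    (h4 : lam₁ = α • (Q - U₁) + lam₀) :
    (aₛ η₁ η₁ + ρs * ‖q₁‖ ^ 2 + ρf * ‖u₁‖ ^ 2
        + Δt * (α * ‖U₁‖ ^ 2 + α⁻¹ * ‖lam₁‖ ^ 2))
      + ρf * ‖u₁ - u₀‖ ^ 2 + 2 * Δt * D + α * Δt * ‖Q - U₀‖ ^ 2
    = aₛ η₀ η₀ + ρs * ‖q₀‖ ^ 2 + ρf * ‖u₀‖ ^ 2
        + Δt * (α * ‖U₀‖ ^ 2 + α⁻¹ * ‖lam₀‖ ^ 2) := by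
  have hs : aₛ ((2:ℝ)⁻¹ • (η₁ + η₀)) ((2:ℝ)⁻¹ • (q₁ + q₀))
      = (2 * Δt)⁻¹ * (aₛ η₁ η₁ - aₛ η₀ η₀) := by
    rw [h1]
    simp only [map_add, map_sub, map_smul, LinearMap.add_apply, LinearMap.smul_apply, smul_eq_mul,
      hsym η₀ η₁, mul_inv]
    ring
  rw [hs] at h2
  subst h4
  simp only [← real_inner_self_eq_norm_sq, inner_add_left, inner_add_right, inner_sub_left,
    inner_sub_right, real_inner_smul_left, real_inner_smul_right] at h2 h3 ⊢
  simp only [real_inner_comm q₀ q₁, real_inner_comm u₀ u₁, real_inner_comm U₀ Q,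
    real_inner_comm U₁ Q, real_inner_comm lam₀ Q, real_inner_comm lam₀ U₁] at h2 h3 ⊢
  field_simp at h2 h3 ⊢
  linear_combination α * h2 + 2 * α * h3
end

section
/- Let V_s, V_f and G be real inner product spaces, let a_s : V_s × V_s → ℝ be a symmetric bilinear form, let ρ_s, ρ_f, α, Δt > 0 and let N ≥ 1. Suppose sequences η^n, q^n ∈ V_s, u^n ∈ V_f, λ^n, U^n ∈ G (0 ≤ n ≤ N), Q^{n+1/2} ∈ G and D^{n+1} ∈ ℝ (0 ≤ n ≤ N−1) satisfy, for every 0 ≤ n ≤ N−1: (i) (q^{n+1} + q^n)/2 = (η^{n+1} − η^n)/Δt; (ii) ρ_s⟨(q^{n+1} − q^n)/Δt, (q^{n+1} + q^n)/2⟩_s + a_s((η^{n+1} + η^n)/2, (q^{n+1} + q^n)/2) + α⟨Q^{n+1/2} − U^n, Q^{n+1/2}⟩_G + ⟨λ^n, Q^{n+1/2}⟩_G = 0; (iii) ρ_f⟨(u^{n+1} − u^n)/Δt, u^{n+1}⟩_f + D^{n+1} + α⟨U^{n+1} − Q^{n+1/2}, U^{n+1}⟩_G − ⟨λ^n, U^{n+1}⟩_G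 = 0; (iv) λ^{n+1} = α(Q^{n+1/2} − U^{n+1}) + λ^n. Define S^n := a_s(η^n, η^n) + ρ_s‖q^n‖_s² + ρ_f‖u^n‖_f² + Δt(α‖U^n‖_G² + (1/α)‖λ^n‖_G²). Then for every 1 ≤ M ≤ N, S^M + Σ_{m=1}^{M} (ρ_f‖u^m − u^{m−1}‖_f² + 2Δt D^m + αΔt‖Q^{m−1/2} − U^{m−1}‖_G²) = S⁰. In particular, if each D^m ≥ 0, then S^M ≤ S⁰ for all M, i.e. the scheme is unconditionally stable. -/
open scoped RealInnerProductSpace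

/-- Testing the difference quotient against the midpoint gives a difference of squares. -/
theorem inner_inv_smul_sub_midpoint {E : Type*} [NormedAddCommGroup E] [InnerProductSpace ℝ E]
    {τ : ℝ} (hτ : τ ≠ 0) (x y : E) :
    2 * τ * ⟪τ⁻¹ • (y - x), (2:ℝ)⁻¹ • (y + x)⟫ = ‖y‖ ^ 2 - ‖x‖ ^ 2 := by
  simp only [real_inner_smul_left, real_inner_smul_right, inner_sub_left, inner_add_right,
    real_inner_self_eq_norm_sq, real_inner_comm y x]
  field_simp
  ring

/-- The polarization identity `2⟪y - x, y⟫ = ‖y‖² - ‖x‖² + ‖y - x‖²`. -/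
theorem two_mul_inner_sub_self {E : Type*} [NormedAddCommGroup E] [InnerProductSpace ℝ E]
    (x y : E) : 2 * ⟪y - x, y⟫ = ‖y‖ ^ 2 - ‖x‖ ^ 2 + ‖y - x‖ ^ 2 := by
  rw [norm_sub_sq_real, inner_sub_left, real_inner_self_eq_norm_sq, real_inner_comm y x]
  ring

/-- A symmetric bilinear form tested with the midpoint and the difference quotient. -/
theorem bilin_midpoint_inv_smul_sub {E : Type*} [AddCommGroup E] [Module ℝ E]
    (a : E →ₗ[ℝ] E →ₗ[ℝ] ℝ) (hsym : ∀ x y, a x y = a y x) {τ : ℝ} (hτ : τ ≠ 0) (x y : E) :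
    2 * τ * a ((2:ℝ)⁻¹ • (y + x)) (τ⁻¹ • (y - x)) = a y y - a x x := by
  simp only [map_smul, map_add, map_sub, LinearMap.smul_apply, LinearMap.add_apply,
    smul_eq_mul, hsym y x]
  field_simp
  ring

/-- Balance of the Robin interface terms over one multiplier update. -/
theorem robin_interface_balance {G : Type*} [NormedAddCommGroup G] [InnerProductSpace ℝ G]
    {α : ℝ} (hα : α ≠ 0) (l l' U U' Q : G) (hl : l' = α • (Q - U') + l) :
    2 * (α * ⟪Q - U, Q⟫ + ⟪l, Q⟫ + (α * ⟪U' - Q, U'⟫ - ⟪l, U'⟫)) =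
      α * ‖U'‖ ^ 2 + α⁻¹ * ‖l'‖ ^ 2 - (α * ‖U‖ ^ 2 + α⁻¹ * ‖l‖ ^ 2) + α * ‖Q - U‖ ^ 2 := by
  have hQ := two_mul_inner_sub_self U Q
  have hU := two_mul_inner_sub_self Q U'
  have hl2 : α⁻¹ * ‖l'‖ ^ 2 =
      α * ‖U' - Q‖ ^ 2 + 2 * (⟪l, Q⟫ - ⟪l, U'⟫) + α⁻¹ * ‖l‖ ^ 2 := by
    rw [hl, norm_add_sq_real, norm_smul, mul_pow, Real.norm_eq_abs, sq_abs,
      real_inner_smul_left, real_inner_comm, inner_sub_right, norm_sub_rev Q U']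
    field_simp
  linear_combination α * hQ + α * hU - hl2

/-- Abstract form of the unconditional stability result (Lemma 3.1) for the fully
discrete Robin-based loosely coupled fluid–structure interaction scheme.
Here `Q n` stands for `Q^{n+1/2}` and `D (n+1)` for `D^{n+1}`. -/
theorem stmt3 {Vs Vf G : Type*}
    [NormedAddCommGroup Vs] [InnerProductSpace ℝ Vs]
    [NormedAddCommGroup Vf] [InnerProductSpace ℝ Vf]
    [NormedAddCommGroup G] [InnerProductSpace ℝ G]
    (aₛ : Vs →ₗ[ℝ] Vs →ₗ[ℝ] ℝ) (hsym : ∀ x y : Vs, aₛ x y = aₛ y x)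
    (ρs ρf α Δt : ℝ) (hρs : 0 < ρs) (hρf : 0 < ρf) (hα : 0 < α) (hΔt : 0 < Δt)
    (N : ℕ) (hN : 1 ≤ N)
    (η q : ℕ → Vs) (u : ℕ → Vf) (lam U Q : ℕ → G) (D : ℕ → ℝ)
    -- (i) the kinematic relation of the midpoint solid scheme
    (h1 : ∀ n, n ≤ N - 1 →
      (2:ℝ)⁻¹ • (q (n+1) + q n) = Δt⁻¹ • (η (n+1) - η n))
    -- (ii) the solid subproblem tested with the midpoint solid velocity
    (h2 : ∀ n, n ≤ N - 1 →
      ρs * ⟪Δt⁻¹ • (q (n+1) - q n), (2:ℝ)⁻¹ • (q (n+1) + q n)⟫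
        + aₛ ((2:ℝ)⁻¹ • (η (n+1) + η n)) ((2:ℝ)⁻¹ • (q (n+1) + q n))
        + α * ⟪Q n - U n, Q n⟫ + ⟪lam n, Q n⟫ = 0)
    -- (iii) the fluid subproblem tested with the fluid velocity
    (h3 : ∀ n, n ≤ N - 1 →
      ρf * ⟪Δt⁻¹ • (u (n+1) - u n), u (n+1)⟫ + D (n+1)
        + α * ⟪U (n+1) - Q n, U (n+1)⟫ - ⟪lam n, U (n+1)⟫ = 0)
    -- (iv) the multiplier update
    (h4 : ∀ n, n ≤ N - 1 →
      lam (n+1) = α • (Q n - U (n+1)) + lam n)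
    -- the discrete energy
    (S : ℕ → ℝ)
    (hS : ∀ n, S n = aₛ (η n) (η n) + ρs * ‖q n‖ ^ 2 + ρf * ‖u n‖ ^ 2
        + Δt * (α * ‖U n‖ ^ 2 + α⁻¹ * ‖lam n‖ ^ 2)) :
    (∀ M, 1 ≤ M → M ≤ N →
      S M + ∑ m ∈ Finset.Icc 1 M,
        (ρf * ‖u m - u (m-1)‖ ^ 2 + 2 * Δt * D m
          + α * Δt * ‖Q (m-1) - U (m-1)‖ ^ 2) = S 0)
    ∧ ((∀ m, 1 ≤ m → m ≤ N → 0 ≤ D m) → ∀ M, M ≤ N → S M ≤ S 0) := by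
  have step : ∀ n, n ≤ N - 1 → S (n + 1) + (ρf * ‖u (n + 1) - u n‖ ^ 2
      + 2 * Δt * D (n + 1) + α * Δt * ‖Q n - U n‖ ^ 2) = S n := by
    intro n hn
    have hsolid := h2 n hn
    have hfluid := h3 n hn
    have hq := inner_inv_smul_sub_midpoint hΔt.ne' (q n) (q (n + 1))
    have hη := bilin_midpoint_inv_smul_sub aₛ hsym hΔt.ne' (η n) (η (n + 1))
    rw [← h1 n hn] at hη
    have hu := two_mul_inner_sub_self (u n) (u (n + 1))
    have hG := robin_interface_balance hα.ne' (lam n) (lam (n + 1)) (U n) (U (n + 1)) (Q n)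
      (h4 n hn)
    have hΔ : Δt * Δt⁻¹ = 1 := mul_inv_cancel₀ hΔt.ne'
    rw [real_inner_smul_left] at hfluid
    rw [hS, hS]
    linear_combination 2 * Δt * hsolid + 2 * Δt * hfluid - ρs * hq - hη - ρf * hu - Δt * hG
      - 2 * ρf * ⟪u (n + 1) - u n, u (n + 1)⟫ * hΔ
  have key : ∀ M, M ≤ N →
      S M + ∑ m ∈ Finset.Icc 1 M,
        (ρf * ‖u m - u (m-1)‖ ^ 2 + 2 * Δt * D m
          + α * Δt * ‖Q (m-1) - U (m-1)‖ ^ 2) = S 0 := by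
    intro M
    induction M with
    | zero => simp
    | succ n ih =>
      intro hn
      rw [Finset.sum_Icc_succ_top (by omega), Nat.add_sub_cancel]
      linear_combination ih (by omega) + step n (by omega)
  refine ⟨fun M _ hM => key M hM, fun hD M hM => ?_⟩
  rw [← key M hM]
  refine le_add_of_nonneg_right (Finset.sum_nonneg fun m hm => ?_)
  rw [Finset.mem_Icc] at hm
  have hDm := hD m hm.1 (hm.2.trans hM)
  positivity
end

section
/- Let G be a real inner product space, let α > 0 and Δt ∈ ℝ, and let U⁰, U¹, D, Λ⁰, Λ¹, g₁, g₂ ∈ G satisfy Λ¹ − Λ⁰ = α(D − U¹) + g₁. Set Q := D − g₂. Then −αΔt⟨U¹ − U⁰, Q⟩ − Δt⟨Λ¹, Q⟩ + Δt⟨Λ¹, U¹⟩ = −(αΔt/2)(‖U¹‖² − ‖U⁰‖² + ‖D − U⁰‖²) − (Δt/(2α))(‖Λ¹‖² − ‖Λ⁰‖²) − (Δt/(2α))‖g₁‖² − Δt⟨D − U⁰, g₁⟩ + Δt⟨Λ¹, g₂ + (1/α)g₁⟩ + Δt⟨U¹ − U⁰, αg₂ + g₁⟩. -/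
open scoped RealInnerProductSpace

/-- Computation of the interface term `J₂` in the proof of the main error estimate
(Theorem 4.4), with consistency perturbations `g₁`, `g₂` in the perturbed multiplier
update `Λ¹ − Λ⁰ = α(D − U¹) + g₁` and the perturbed kinematic relation `Q = D − g₂`. -/
theorem stmt5 {G : Type*} [NormedAddCommGroup G] [InnerProductSpace ℝ G]
    (α Δt : ℝ) (hα : 0 < α) (U₀ U₁ D Λ₀ Λ₁ g₁ g₂ : G)
    (hupd : Λ₁ - Λ₀ = α • (D - U₁) + g₁) (Q : G) (hQ : Q = D - g₂) :
    -(α * Δt) * ⟪U₁ - U₀, Q⟫ - Δt * ⟪Λ₁, Q⟫ + Δt * ⟪Λ₁, U₁⟫ =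
      -(α * Δt / 2) * (‖U₁‖ ^ 2 - ‖U₀‖ ^ 2 + ‖D - U₀‖ ^ 2)
        - Δt / (2 * α) * (‖Λ₁‖ ^ 2 - ‖Λ₀‖ ^ 2)
        - Δt / (2 * α) * ‖g₁‖ ^ 2
        - Δt * ⟪D - U₀, g₁⟫
        + Δt * ⟪Λ₁, g₂ + α⁻¹ • g₁⟫
        + Δt * ⟪U₁ - U₀, α • g₂ + g₁⟫ := by
  have hΛ₀ : Λ₀ = Λ₁ - (α • (D - U₁) + g₁) := by rw [← hupd]; abel
  subst hQ hΛ₀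
  simp only [← real_inner_self_eq_norm_sq, inner_sub_left, inner_sub_right, inner_add_left,
    inner_add_right, real_inner_smul_left, real_inner_smul_right]
  rw [real_inner_comm U₁ D, real_inner_comm U₀ D, real_inner_comm Λ₁ D, real_inner_comm Λ₁ U₁,
    real_inner_comm Λ₁ g₁, real_inner_comm D g₁, real_inner_comm U₁ g₁]
  field_simp
  ring
end

section
/- Let E be a real Banach space, let a < b be real numbers, and let w : ℝ → E be three times continuously differentiable on [a, b]. Then ‖(w(b) − w(a))/(b − a) − (w′(a) + w′(b))/2‖² ≤ ((b − a)³/120) ∫_a^b ‖w‴(s)‖² ds. -/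
open intervalIntegral

/-- Cauchy–Schwarz inequality for continuous real functions on a compact interval. -/
theorem sq_integral_mul_le_of_continuousOn {a b : ℝ} (hab : a ≤ b) {f g : ℝ → ℝ}
    (hf : ContinuousOn f (Set.Icc a b)) (hg : ContinuousOn g (Set.Icc a b)) :
    (∫ s in a..b, f s * g s) ^ 2 ≤ (∫ s in a..b, f s ^ 2) * ∫ s in a..b, g s ^ 2 := by
  rw [← Set.uIcc_of_le hab] at hf hg
  have hff : IntervalIntegrable (fun s ↦ f s ^ 2) MeasureTheory.volume a b :=
    (hf.pow 2).intervalIntegrable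
  have hgg : IntervalIntegrable (fun s ↦ g s ^ 2) MeasureTheory.volume a b :=
    (hg.pow 2).intervalIntegrable
  have hfg : IntervalIntegrable (fun s ↦ f s * g s) MeasureTheory.volume a b :=
    (hf.mul hg).intervalIntegrable
  have hquad (t : ℝ) : 0 ≤ (∫ s in a..b, f s ^ 2) * (t * t) +
      (2 * ∫ s in a..b, f s * g s) * t + ∫ s in a..b, g s ^ 2 := by
    have hexp : ∫ s in a..b, (t * f s + g s) ^ 2 = (∫ s in a..b, f s ^ 2) * (t * t) +
        (2 * ∫ s in a..b, f s * g s) * t + ∫ s in a..b, g s ^ 2 := by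
      rw [← integral_mul_const, ← integral_const_mul, ← integral_mul_const,
        ← integral_add (hff.mul_const _) ((hfg.const_mul _).mul_const _),
        ← integral_add ((hff.mul_const _).add ((hfg.const_mul _).mul_const _)) hgg]
      congr 1
      ext s
      ring
    rw [← hexp]
    exact integral_nonneg hab fun s _ ↦ sq_nonneg _
  have h := discrim_le_zero hquad
  rw [discrim] at h
  linarith

/-- The Peano kernel representation of the error of the trapezoidal rule. -/
theorem integral_kernel_smul_third_deriv {E : Type*} [NormedAddCommGroup E] [NormedSpace ℝ E]
    [CompleteSpace E] {a b : ℝ} (hab : a ≤ b) {w w' w'' w''' : ℝ → E}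
    (hw : ∀ s ∈ Set.Icc a b, HasDerivWithinAt w (w' s) (Set.Icc a b) s)
    (hw' : ∀ s ∈ Set.Icc a b, HasDerivWithinAt w' (w'' s) (Set.Icc a b) s)
    (hw'' : ∀ s ∈ Set.Icc a b, HasDerivWithinAt w'' (w''' s) (Set.Icc a b) s)
    (hcont : ContinuousOn w''' (Set.Icc a b)) :
    ∫ s in a..b, ((b - s) * (s - a)) • w''' s =
      (b - a) • (w' a + w' b) - (2 : ℝ) • (w b - w a) := by
  have hF : ∀ s ∈ Set.Icc a b, HasDerivWithinAt
      (fun s ↦ ((b - s) * (s - a)) • w'' s - (a + b - 2 * s) • w' s - (2 : ℝ) • w s)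
      (((b - s) * (s - a)) • w''' s) (Set.Icc a b) s := by
    intro s hs
    have hk : HasDerivWithinAt (fun s : ℝ ↦ (b - s) * (s - a)) (a + b - 2 * s)
        (Set.Icc a b) s := by
      refine ((((hasDerivAt_id' s).const_sub b).mul
        ((hasDerivAt_id' s).sub_const a)).congr_deriv ?_).hasDerivWithinAt
      ring
    have hk' : HasDerivWithinAt (fun s : ℝ ↦ a + b - 2 * s) (-2) (Set.Icc a b) s := by
      simpa using (((hasDerivAt_id s).const_mul 2).const_sub (a + b)).hasDerivWithinAt
    refine (((hk.smul (hw'' s hs)).sub (hk'.smul (hw' s hs))).sub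
      ((hw s hs).const_smul (2 : ℝ))).congr_deriv ?_
    module
  rw [integral_eq_sub_of_hasDerivAt_of_le hab (fun s hs ↦ (hF s hs).continuousWithinAt)
    (fun s hs ↦ (hF s (Set.Ioo_subset_Icc_self hs)).hasDerivAt (Icc_mem_nhds hs.1 hs.2))]
  · module
  · refine ContinuousOn.intervalIntegrable ?_
    rw [Set.uIcc_of_le hab]
    exact ContinuousOn.smul (by fun_prop) hcont

theorem integral_sq_kernel (a b : ℝ) :
    ∫ s in a..b, ((b - s) * (s - a)) ^ 2 = (b - a) ^ 5 / 30 := by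
  have hF (s : ℝ) : HasDerivAt
      (fun s ↦ (b - a) ^ 2 * (s - a) ^ 3 / 3 - (b - a) * (s - a) ^ 4 / 2 + (s - a) ^ 5 / 5)
      (((b - s) * (s - a)) ^ 2) s := by
    have h := (hasDerivAt_id' s).sub_const a
    refine (((((h.pow 3).const_mul ((b - a) ^ 2)).div_const 3).sub
      (((h.pow 4).const_mul (b - a)).div_const 2)).add
        ((h.pow 5).div_const 5)).congr_deriv ?_
    push_cast
    ring
  rw [integral_eq_sub_of_hasDerivAt (fun s _ ↦ hF s)
    (Continuous.intervalIntegrable (by fun_prop) _ _)]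
  ring



/-- Midpoint-scheme consistency bound (used for estimates (tt1), (tt3), (tt6) of
Lemma 4.3): for `w` three times continuously differentiable on `[a,b]`,
`‖(w(b)−w(a))/(b−a) − (w′(a)+w′(b))/2‖² ≤ ((b−a)³/120) ∫_a^b ‖w‴(s)‖² ds`. -/
theorem stmt7 {E : Type*} [NormedAddCommGroup E] [NormedSpace ℝ E] [CompleteSpace E]
    (a b : ℝ) (hab : a < b) (w w' w'' w''' : ℝ → E)
    (hw : ∀ s ∈ Set.Icc a b, HasDerivWithinAt w (w' s) (Set.Icc a b) s)
    (hw' : ∀ s ∈ Set.Icc a b, HasDerivWithinAt w' (w'' s) (Set.Icc a b) s)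
    (hw'' : ∀ s ∈ Set.Icc a b, HasDerivWithinAt w'' (w''' s) (Set.Icc a b) s)
    (hcont : ContinuousOn w''' (Set.Icc a b)) :
    ‖(b - a)⁻¹ • (w b - w a) - (2:ℝ)⁻¹ • (w' a + w' b)‖ ^ 2 ≤
      (b - a) ^ 3 / 120 * ∫ s in a..b, ‖w''' s‖ ^ 2 := by
  have hba : b - a ≠ 0 := (sub_pos.2 hab).ne'
  have hrepr : (b - a)⁻¹ • (w b - w a) - (2 : ℝ)⁻¹ • (w' a + w' b) =
      (-(2 * (b - a))⁻¹) • ∫ s in a..b, ((b - s) * (s - a)) • w''' s := by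
    rw [integral_kernel_smul_third_deriv hab.le hw hw' hw'' hcont]
    match_scalars <;> field_simp
  have hnorm : ‖∫ s in a..b, ((b - s) * (s - a)) • w''' s‖ ≤
      ∫ s in a..b, ((b - s) * (s - a)) * ‖w''' s‖ := by
    refine (norm_integral_le_integral_norm hab.le).trans_eq (integral_congr fun s hs ↦ ?_)
    rw [Set.uIcc_of_le hab.le] at hs
    simp only [norm_smul]
    rw [Real.norm_of_nonneg (mul_nonneg (sub_nonneg.2 hs.2) (sub_nonneg.2 hs.1))]
  have hcs := sq_integral_mul_le_of_continuousOn hab.le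
    (f := fun s ↦ (b - s) * (s - a)) (by fun_prop) hcont.norm
  rw [integral_sq_kernel] at hcs
  rw [hrepr, norm_smul, mul_pow, Real.norm_eq_abs, sq_abs]
  calc _ ≤ (-(2 * (b - a))⁻¹) ^ 2 * ((b - a) ^ 5 / 30 * ∫ s in a..b, ‖w''' s‖ ^ 2) := by
        gcongr
        exact (pow_le_pow_left₀ (norm_nonneg _) hnorm 2).trans hcs
    _ = _ := by
        field_simp
        ring
end

section
/- Let E be a real Banach space, let a < b be real numbers, and let w : ℝ → E be continuously differentiable on [a, b]. Then ‖(w(a) + w(b))/2 − (1/(b − a)) ∫_a^b w(s) ds‖² ≤ ((b − a)/12) ∫_a^b ‖w′(s)‖² ds. -/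
open intervalIntegral

theorem intervalIntegral.sq_integral_mul_le {f g : ℝ → ℝ} {a b : ℝ} (hab : a ≤ b)
    (hf : ContinuousOn f (Set.Icc a b)) (hg : ContinuousOn g (Set.Icc a b))
    (hpos : 0 < ∫ s in a..b, f s ^ 2) :
    (∫ s in a..b, f s * g s) ^ 2 ≤ (∫ s in a..b, f s ^ 2) * ∫ s in a..b, g s ^ 2 := by
  rw [← Set.uIcc_of_le hab] at hf hg
  set F := ∫ s in a..b, f s ^ 2
  set C := ∫ s in a..b, f s * g s
  have hff : IntervalIntegrable (fun s => f s ^ 2) MeasureTheory.volume a b :=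
    (hf.pow 2).intervalIntegrable
  have hgg : IntervalIntegrable (fun s => g s ^ 2) MeasureTheory.volume a b :=
    (hg.pow 2).intervalIntegrable
  have hfg : IntervalIntegrable (fun s => f s * g s) MeasureTheory.volume a b :=
    (hf.mul hg).intervalIntegrable
  have h : 0 ≤ ∫ s in a..b, (F * g s - C * f s) ^ 2 :=
    integral_nonneg hab fun s _ => sq_nonneg _
  have heq : (∫ s in a..b, (F * g s - C * f s) ^ 2) =
      F ^ 2 * (∫ s in a..b, g s ^ 2) - 2 * F * C * C + C ^ 2 * F := by
    calc (∫ s in a..b, (F * g s - C * f s) ^ 2)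
        = ∫ s in a..b, F ^ 2 * g s ^ 2 - 2 * F * C * (f s * g s) + C ^ 2 * f s ^ 2 := by
          congr 1 with s
          ring
      _ = F ^ 2 * (∫ s in a..b, g s ^ 2) - 2 * F * C * C + C ^ 2 * F := by
          rw [integral_add ((hgg.const_mul _).sub (hfg.const_mul _)) (hff.const_mul _),
            integral_sub (hgg.const_mul _) (hfg.const_mul _), integral_const_mul,
            integral_const_mul, integral_const_mul]
  rw [heq] at h
  refine le_of_mul_le_mul_left ?_ hpos
  linarith

theorem integral_sq_two_mul_sub_add (a b : ℝ) :
    ∫ s in a..b, (2 * s - (a + b)) ^ 2 = (b - a) ^ 3 / 3 := by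
  have h : ∀ s ∈ Set.uIcc a b,
      HasDerivAt (fun s : ℝ => (2 * s - (a + b)) ^ 3 / 6) ((2 * s - (a + b)) ^ 2) s := by
    intro s _
    have hk : HasDerivAt (fun s : ℝ => 2 * s - (a + b)) 2 s := by
      simpa using ((hasDerivAt_id s).const_mul 2).sub_const (a + b)
    refine ((hk.fun_pow 3).div_const 6).congr_deriv ?_
    push_cast
    ring
  rw [integral_eq_sub_of_hasDerivAt h (Continuous.intervalIntegrable (by fun_prop) _ _)]
  ring

theorem average_endpoints_sub_average_eq_integral {E : Type*} [NormedAddCommGroup E]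
    [NormedSpace ℝ E] [CompleteSpace E] {a b : ℝ} (hab : a < b) {w w' : ℝ → E}
    (hw : ∀ s ∈ Set.Icc a b, HasDerivWithinAt w (w' s) (Set.Icc a b) s)
    (hcont : ContinuousOn w' (Set.Icc a b)) :
    (2:ℝ)⁻¹ • (w a + w b) - (b - a)⁻¹ • ∫ s in a..b, w s =
      (2 * (b - a))⁻¹ • ∫ s in a..b, (2 * s - (a + b)) • w' s := by
  have hwc : ContinuousOn w (Set.Icc a b) := fun s hs => (hw s hs).continuousWithinAt
  have hk : Continuous fun s : ℝ => 2 * s - (a + b) := by fun_prop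
  have hkw' : IntervalIntegrable (fun s => (2 * s - (a + b)) • w' s)
      MeasureTheory.volume a b :=
    ContinuousOn.intervalIntegrable_of_Icc hab.le (hk.continuousOn.smul hcont)
  have h2w : IntervalIntegrable (fun s => (2 : ℝ) • w s) MeasureTheory.volume a b :=
    ContinuousOn.intervalIntegrable_of_Icc hab.le (hwc.const_smul _)
  have hderiv : ∀ s ∈ Set.Ioo a b, HasDerivAt (fun s => (2 * s - (a + b)) • w s)
      ((2 * s - (a + b)) • w' s + (2 : ℝ) • w s) s := by
    intro s hs
    have hk' : HasDerivAt (fun s : ℝ => 2 * s - (a + b)) 2 s := by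
      simpa using ((hasDerivAt_id s).const_mul 2).sub_const (a + b)
    exact hk'.smul ((hw s (Set.Ioo_subset_Icc_self hs)).hasDerivAt (Icc_mem_nhds hs.1 hs.2))
  have hparts := integral_eq_sub_of_hasDerivAt_of_le hab.le (hk.continuousOn.smul hwc) hderiv
    (hkw'.add h2w)
  simp only [integral_add hkw' h2w, integral_smul, Pi.smul_apply'] at hparts
  have hne : b - a ≠ 0 := sub_ne_zero.2 hab.ne'
  rw [eq_sub_of_add_eq hparts]
  match_scalars <;> field_simp <;> ring


/-- Bound used for estimate (tt9) of Lemma 4.3: for `w` continuously differentiable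
on `[a,b]`,
`‖(w(a)+w(b))/2 − (1/(b−a)) ∫_a^b w(s) ds‖² ≤ ((b−a)/12) ∫_a^b ‖w′(s)‖² ds`. -/
theorem stmt13 {E : Type*} [NormedAddCommGroup E] [NormedSpace ℝ E] [CompleteSpace E]
    (a b : ℝ) (hab : a < b) (w w' : ℝ → E)
    (hw : ∀ s ∈ Set.Icc a b, HasDerivWithinAt w (w' s) (Set.Icc a b) s)
    (hcont : ContinuousOn w' (Set.Icc a b)) :
    ‖(2:ℝ)⁻¹ • (w a + w b) - (b - a)⁻¹ • ∫ s in a..b, w s‖ ^ 2 ≤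
      (b - a) / 12 * ∫ s in a..b, ‖w' s‖ ^ 2 := by
  have hba : 0 < b - a := sub_pos.2 hab
  have hk : Continuous fun s : ℝ => 2 * s - (a + b) := by fun_prop
  have hsq : (∫ s in a..b, |2 * s - (a + b)| ^ 2) = (b - a) ^ 3 / 3 := by
    simp_rw [sq_abs]
    exact integral_sq_two_mul_sub_add a b
  have hnorm : ‖∫ s in a..b, (2 * s - (a + b)) • w' s‖ ≤
      ∫ s in a..b, |2 * s - (a + b)| * ‖w' s‖ := by
    simpa only [norm_smul, Real.norm_eq_abs] using
      norm_integral_le_integral_norm (f := fun s => (2 * s - (a + b)) • w' s) hab.le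
  have hcs := sq_integral_mul_le hab.le hk.abs.continuousOn hcont.norm
    (by rw [hsq]; positivity)
  rw [hsq] at hcs
  rw [average_endpoints_sub_average_eq_integral hab hw hcont, norm_smul, mul_pow,
    Real.norm_eq_abs, sq_abs]
  calc (2 * (b - a))⁻¹ ^ 2 * ‖∫ s in a..b, (2 * s - (a + b)) • w' s‖ ^ 2
      ≤ (2 * (b - a))⁻¹ ^ 2 * ((b - a) ^ 3 / 3 * ∫ s in a..b, ‖w' s‖ ^ 2) := by
        gcongr
        exact (pow_le_pow_left₀ (norm_nonneg _) hnorm 2).trans hcs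
    _ = (b - a) / 12 * ∫ s in a..b, ‖w' s‖ ^ 2 := by
        field_simp
        ring
end
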